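/- For all integers k ≥ 3 and g ≥ 3, there exist infinitely many integers v such that a vgr(v, k, g, 1)-graph exists. -/

import Mathlib

open SimpleGraph

/-- The number of closed walks based at `u` of length `g` that are cycles.
Since each (unoriented, basepoint-free) cycle of length `g ≥ 3` through `u`
corresponds to exactly two such closed walks (one for each orientation), this
equals twice the number of cycles of length `g` containing `u`. -/
noncomputable def vertexCycleCount {V : Type*} (G : SimpleGraph V) (g : ℕ) (u : V) : ℕ :=
  Nat.card {p : G.Walk u u // p.IsCycle ∧ p.length = g}

/-- `IsVGR G v k g lam` says that `G` is a vertex-girth-regular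
`vgr(v,k,g,lam)`-graph: a finite simple `k`-regular graph of girth `g` on `v`
vertices in which every vertex lies on exactly `lam` cycles of length `g`
(encoded as: `2 * lam` closed cycle-walks based at each vertex). -/
def IsVGR {V : Type*} (G : SimpleGraph V) (v k g lam : ℕ) : Prop :=
  Finite V ∧ Nat.card V = v ∧ (∀ u : V, Nat.card (G.neighborSet u) = k) ∧
    G.girth = (g : ℕ∞) ∧ ∀ u : V, vertexCycleCount G g u = 2 * lam

section ReducedWords

/-- Words of length at most `n` in the letters `C` without two equal consecutive letters. -/
abbrev ReducedWord (C : Type) (n : ℕ) : Type :=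
  {w : List C // w.IsChain (· ≠ ·) ∧ w.length ≤ n}

variable {C : Type} {n : ℕ}

instance [Finite C] : Finite (ReducedWord C n) :=
  ((List.finite_length_le C n).subset fun _ hw => hw.2 :
    {w : List C | w.IsChain (· ≠ ·) ∧ w.length ≤ n}.Finite)

open Classical in
/-- Left multiplication by the involution `c` on reduced words, fixing the words of maximal length
that do not start with `c`. -/
noncomputable def letterMul (c : C) (w : ReducedWord C n) : ReducedWord C n :=
  if h : c ∈ w.1.head? then ⟨w.1.tail, w.2.1.tail, by
    have := w.2.2
    simp only [List.length_tail]
    omega⟩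
  else if h' : w.1.length < n then
    ⟨c :: w.1, List.isChain_cons.2 ⟨fun _ hy hc => h (hc ▸ hy), w.2.1⟩, h'⟩
  else w

lemma letterMul_involutive (c : C) : Function.Involutive (letterMul (n := n) c) := by
  rintro ⟨w, hw, hn⟩
  by_cases h : c ∈ w.head?
  · obtain ⟨t, rfl⟩ : ∃ t, w = c :: t := by
      cases w <;> simp_all
    have ht : c ∉ t.head? := fun hc => (List.isChain_cons.1 hw).1 c hc rfl
    have hl : t.length < n := by simpa using hn
    simp_all [letterMul]
  · by_cases h' : w.length < n
    · simp_all [letterMul]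
    · have hfix : letterMul c ⟨w, hw, hn⟩ = ⟨w, hw, hn⟩ := by
        simp only [letterMul, h, h', dite_false]
      rw [hfix, hfix]

lemma exists_finite_group_of_involutions (C : Type) [Finite C] (n : ℕ) :
    ∃ (H : Type) (_ : Group H) (_ : Finite H) (b : C → H), (∀ c, b c * b c = 1) ∧
      ∀ w : List C, w.IsChain (· ≠ ·) → w.length ≤ n → (w.map b).prod = 1 → w = [] := by
  refine ⟨Equiv.Perm (ReducedWord C n), inferInstance, inferInstance,
    fun c => (letterMul_involutive c).toPerm, fun c => ?_, fun w hw hn h => ?_⟩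
  · ext1 x
    exact letterMul_involutive c x
  · have key : ∀ w : List C, w.IsChain (· ≠ ·) → w.length ≤ n →
        ((w.map fun c => (letterMul_involutive (n := n) c).toPerm).prod
          ⟨[], .nil, Nat.zero_le n⟩).1 = w := by
      intro w
      induction w with
      | nil => simp
      | cons c w ih =>
        intro hw hn
        obtain ⟨hc, hw⟩ := List.isChain_cons.1 hw
        have hn' : w.length < n := by simpa using hn
        have ih := ih hw hn'.le
        have hc' : c ∉ w.head? := fun h => hc c h rfl
        rw [List.map_cons, List.prod_cons, Equiv.Perm.mul_apply]
        simp only [Function.Involutive.coe_toPerm, letterMul, ih, hc', hn', dite_true, dite_false]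
    rw [← key w hw hn, h]
    rfl

end ReducedWords

section RingReplacement

variable {H ι : Type} [Group H] {g : ℕ} {b : ZMod g × ι → H}

/-- The graph obtained from the Cayley graph of `H` with respect to the involutions `b` by replacing
each vertex by a ring of length `g`, the edges labelled `(i, j)` being attached at position `i`. -/
def ringReplacement (b : ZMod g × ι → H) : SimpleGraph (H × ZMod g) :=
  SimpleGraph.fromRel fun x y =>
    y = (x.1, x.2 + 1) ∨ ∃ j, y = (x.1 * b (x.2, j), x.2)

/-- The `b c` are involutions, and nonempty reduced words of length at most `g` in them are
nontrivial. -/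
structure IsLocallyFree (b : ZMod g × ι → H) : Prop where
  mul_self : ∀ c, b c * b c = 1
  eq_nil : ∀ w : List (ZMod g × ι), w.IsChain (· ≠ ·) → w.length ≤ g → (w.map b).prod = 1 → w = []

namespace IsLocallyFree

lemma ne_one (hb : IsLocallyFree b) (hg : 3 ≤ g) (c : ZMod g × ι) : b c ≠ 1 := fun h => by
  simpa using hb.eq_nil [c] (by simp) (by simp; omega) (by simpa using h)

lemma injective (hb : IsLocallyFree b) (hg : 3 ≤ g) : Function.Injective b := fun c d h => by
  by_contra hcd
  simpa using hb.eq_nil [c, d] (by simpa using hcd) (by simp; omega)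
    (by simpa [h] using hb.mul_self d)

end IsLocallyFree

lemma ZMod.one_ne_neg_one_of_three_le (hg : 3 ≤ g) : (1 : ZMod g) ≠ -1 := by
  have : Fact (2 < g) := ⟨hg⟩
  exact (ZMod.neg_one_ne_one).symm

lemma ringReplacement_adj (hb : IsLocallyFree b) (hg : 3 ≤ g) {x y : H × ZMod g} :
    (ringReplacement b).Adj x y ↔
      (y = (x.1, x.2 + 1) ∨ y = (x.1, x.2 - 1)) ∨ ∃ j, y = (x.1 * b (x.2, j), x.2) := by
  have : Fact (1 < g) := ⟨by omega⟩
  obtain ⟨h, i⟩ := x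
  obtain ⟨h', i'⟩ := y
  simp only [ringReplacement, SimpleGraph.fromRel_adj, Prod.mk.injEq, ne_eq]
  constructor
  · rintro ⟨-, (⟨rfl, rfl⟩ | ⟨j, rfl, rfl⟩) | (⟨rfl, rfl⟩ | ⟨j, rfl, rfl⟩)⟩
    · simp
    · exact .inr ⟨j, rfl, rfl⟩
    · simp
    · exact .inr ⟨j, by rw [mul_assoc, hb.mul_self, mul_one], rfl⟩
  · have h1 : (1 : ZMod g) ≠ 0 := one_ne_zero
    rintro ((⟨rfl, rfl⟩ | ⟨rfl, rfl⟩) | ⟨j, rfl, rfl⟩)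
    · simp
    · exact ⟨fun h => h1 (sub_eq_self.1 h.2.symm), by simp⟩
    · exact ⟨fun h => hb.ne_one hg _ (left_eq_mul.1 h.1), .inl (.inr ⟨j, rfl, rfl⟩)⟩

lemma natCard_neighborSet_ringReplacement [Finite ι] (hb : IsLocallyFree b) (hg : 3 ≤ g)
    (x : H × ZMod g) : Nat.card ((ringReplacement b).neighborSet x) = Nat.card ι + 2 := by
  have h1 := ZMod.one_ne_neg_one_of_three_le hg
  let f : ι ⊕ Bool → H × ZMod g := Sum.elim (fun j => (x.1 * b (x.2, j), x.2))
    fun ε => (x.1, x.2 + if ε then 1 else -1)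
  have hf : Function.Injective f := by
    refine Function.Injective.sumElim (fun j j' h => ?_) ?_ fun j ε h => ?_
    · simpa using hb.injective hg (mul_left_cancel (congrArg Prod.fst h))
    · rintro (_ | _) (_ | _) h <;> simp_all [eq_comm]
    · exact hb.ne_one hg _ (mul_eq_left.1 (congrArg Prod.fst h))
  have hr : (ringReplacement b).neighborSet x = Set.range f := by
    ext y
    rw [SimpleGraph.mem_neighborSet, ringReplacement_adj hb hg]
    simp [f, eq_comm, sub_eq_add_neg]
    tauto
  rw [hr, Nat.card_range_of_injective hf, Nat.card_sum]
  simp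

lemma exists_reduced_word_of_isTrail (hb : IsLocallyFree b) (hg : 3 ≤ g) {v u : H × ZMod g}
    (p : (ringReplacement b).Walk v u) (hp : p.IsTrail) :
    ∃ w : List (ZMod g × ι), w.IsChain (· ≠ ·) ∧ w.length ≤ p.length ∧
      u.1 = v.1 * (w.map b).prod ∧
      (∀ c ∈ w.head?, s((v.1, c.1), (v.1 * b c, c.1)) ∈ p.edges) ∧
      (w = [] → ∀ x ∈ p.support, x.1 = v.1) := by
  induction p with
  | nil => exact ⟨[], by simp⟩
  | @cons v' v u h p ih =>
    obtain ⟨hp, he⟩ := (Walk.isTrail_cons h p).1 hp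
    obtain ⟨w, hw, hl, hu, hs, hn⟩ := ih hp
    rcases (ringReplacement_adj hb hg).1 h with hv | ⟨j, hv⟩
    · have hv : v.1 = v'.1 := by rcases hv with rfl | rfl <;> rfl
      rw [hv] at hs hn hu
      refine ⟨w, hw, by simp; omega, hu, fun c hc => ?_, fun h0 x hx => ?_⟩
      · exact List.mem_cons_of_mem _ (hs c hc)
      · rcases List.mem_cons.1 hx with rfl | hx
        exacts [rfl, hn h0 x hx]
    · have hv1 : v.1 * b (v'.2, j) = v'.1 := by
        rw [hv, mul_assoc, hb.mul_self, mul_one]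
      have hedge : s(v', v) = s((v'.1, v'.2), (v'.1 * b (v'.2, j), v'.2)) := by rw [hv]
      refine ⟨(v'.2, j) :: w, List.isChain_cons.2 ⟨fun c hc hne => he ?_, hw⟩, by simpa using hl,
        ?_, fun c hc => ?_, by simp⟩
      · have := hs c hc
        rw [← hne, hv1] at this
        rw [hedge, Sym2.eq_swap]
        rwa [show v.1 = v'.1 * b (v'.2, j) from congrArg Prod.fst hv] at this
      · rw [hu, List.map_cons, List.prod_cons, ← mul_assoc, hv]
      · obtain rfl : (v'.2, j) = c := by simpa using hc
        rw [← hedge]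
        simp

lemma fst_eq_of_isTrail (hb : IsLocallyFree b) (hg : 3 ≤ g) {u : H × ZMod g}
    (p : (ringReplacement b).Walk u u) (hp : p.IsTrail) (hl : p.length ≤ g) :
    ∀ x ∈ p.support, x.1 = u.1 := by
  obtain ⟨w, hw, hwl, hu, -, hn⟩ := exists_reduced_word_of_isTrail hb hg p hp
  exact hn (hb.eq_nil w hw (hwl.trans hl) (left_eq_mul.1 hu))

lemma exists_getVert_eq_of_isTrail (hb : IsLocallyFree b) (hg : 3 ≤ g) {v u : H × ZMod g}
    (p : (ringReplacement b).Walk v u) (hp : p.IsTrail) (hs : ∀ x ∈ p.support, x.1 = v.1) :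
    ∃ ε : ZMod g, (ε = 1 ∨ ε = -1) ∧ ∀ j ≤ p.length, p.getVert j = (v.1, v.2 + j * ε) := by
  induction p with
  | nil => exact ⟨1, by simp⟩
  | @cons v' v u h p ih =>
    obtain ⟨hp, he⟩ := (Walk.isTrail_cons h p).1 hp
    have hv : v.1 = v'.1 := hs v (by simp)
    obtain ⟨ε, hε, hj⟩ := ih hp fun x hx => by rw [hv]; exact hs x (by simp [hx])
    obtain ⟨δ, hδ, hvδ⟩ : ∃ δ : ZMod g, (δ = 1 ∨ δ = -1) ∧ v = (v'.1, v'.2 + δ) := by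
      rcases (ringReplacement_adj hb hg).1 h with (h | h) | ⟨j, h⟩
      · exact ⟨1, by simp, h⟩
      · exact ⟨-1, by simp, by rw [h, sub_eq_add_neg]⟩
      · rw [h] at hv
        exact absurd (mul_eq_left.1 hv) (hb.ne_one hg _)
    refine ⟨δ, hδ, fun j hjl => ?_⟩
    rcases j with _ | j
    · simp
    rw [Walk.getVert_cons_succ]
    rw [Walk.length_cons] at hjl
    rcases j with _ | j
    · simp [hvδ]
    have hεδ : ε = δ := by
      by_contra hne
      have hεδ : ε = -δ := by rcases hε with rfl | rfl <;> rcases hδ with rfl | rfl <;> simp_all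
      have h1 : p.getVert 1 = v' := by
        rw [hj 1 (by omega), hvδ, hεδ]
        simp
      apply he
      cases p with
      | nil => simp at hjl
      | cons h' q =>
        rw [Walk.getVert_cons_succ, Walk.getVert_zero] at h1
        simp [h1, Sym2.eq_swap]
    rw [hj _ (by omega), hεδ, hvδ]
    push_cast
    ring_nf

lemma length_eq_of_isCycle (hb : IsLocallyFree b) (hg : 3 ≤ g) {u : H × ZMod g}
    (p : (ringReplacement b).Walk u u) (hp : p.IsCycle) (hl : p.length ≤ g) : p.length = g := by
  obtain ⟨ε, hε, hj⟩ := exists_getVert_eq_of_isTrail hb hg p hp.isTrail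
    (fst_eq_of_isTrail hb hg p hp.isTrail hl)
  have h := congrArg Prod.snd (hj _ le_rfl)
  rw [Walk.getVert_length, left_eq_add] at h
  have h0 : (p.length : ZMod g) = 0 := by rcases hε with rfl | rfl <;> simpa using h
  exact hl.antisymm (Nat.le_of_dvd (by have := hp.three_le_length; omega)
    ((ZMod.natCast_eq_zero_iff _ _).1 h0))

lemma exists_isPath_ring (hb : IsLocallyFree b) (hg : 3 ≤ g) (u : H × ZMod g) (m : ℕ) (hm : m < g) :
    ∃ p : (ringReplacement b).Walk u (u.1, u.2 + m), p.IsPath ∧ p.length = m ∧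
      ∀ x ∈ p.support, ∃ j ≤ m, x = (u.1, u.2 + (j : ZMod g)) := by
  induction m with
  | zero => exact ⟨Walk.nil.copy rfl (by simp), by simp, by simp, by simp⟩
  | succ m ih =>
    obtain ⟨p, hp, hl, hs⟩ := ih (by omega)
    have hadj : (ringReplacement b).Adj (u.1, u.2 + (m : ZMod g))
        (u.1, u.2 + ((m + 1 : ℕ) : ZMod g)) :=
      (ringReplacement_adj hb hg).2 (.inl (.inl (by push_cast; rw [add_assoc])))
    refine ⟨p.concat hadj, hp.concat (fun hmem => ?_) hadj, by simp [hl], fun x hx => ?_⟩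
    · obtain ⟨j, hj, h⟩ := hs _ hmem
      have h : ((m + 1 : ℕ) : ZMod g) = j := by simpa using h
      rw [ZMod.natCast_eq_natCast_iff', Nat.mod_eq_of_lt hm, Nat.mod_eq_of_lt (by omega)] at h
      omega
    · rw [Walk.support_concat] at hx
      rcases List.mem_append.1 hx with hx | hx
      · obtain ⟨j, hj, rfl⟩ := hs x hx
        exact ⟨j, by omega, rfl⟩
      · exact ⟨m + 1, le_rfl, by simpa using hx⟩

lemma exists_isCycle_ring (hb : IsLocallyFree b) (hg : 3 ≤ g) (u : H × ZMod g) :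
    ∃ p : (ringReplacement b).Walk u u, p.IsCycle ∧ p.length = g := by
  obtain ⟨p, hp, hl, -⟩ := exists_isPath_ring hb hg (u.1, u.2 + 1) (g - 1) (by omega)
  have hu : (u.1, u.2 + 1 + ((g - 1 : ℕ) : ZMod g)) = u := by
    rw [Nat.cast_sub (by omega)]
    simp
  have hadj : (ringReplacement b).Adj u (u.1, u.2 + 1) := (ringReplacement_adj hb hg).2 (by simp)
  refine ⟨.cons hadj (p.copy rfl hu), (Walk.cons_isCycle_iff _ _).2 ⟨by simpa using hp, fun h => ?_⟩,
    by simp [hl]; omega⟩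
  have := Walk.IsPath.length_eq_one_of_mem_edges (p := p.copy rfl hu) (by simpa using hp)
    (Sym2.eq_swap ▸ h)
  simp at this
  omega

lemma vertexCycleCount_ringReplacement (hb : IsLocallyFree b) (hg : 3 ≤ g) (u : H × ZMod g) :
    vertexCycleCount (ringReplacement b) g u = 2 := by
  have hring : ∀ p : (ringReplacement b).Walk u u, p.IsCycle ∧ p.length = g →
      ∃ ε : ZMod g, (ε = 1 ∨ ε = -1) ∧ ∀ j ≤ g, p.getVert j = (u.1, u.2 + j * ε) := fun p hp => by
    simpa only [hp.2] using exists_getVert_eq_of_isTrail hb hg p hp.1.isTrail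
      (fst_eq_of_isTrail hb hg p hp.1.isTrail hp.2.le)
  obtain ⟨p, hp⟩ := exists_isCycle_ring hb hg u
  obtain ⟨ε, hε, hpε⟩ := hring p hp
  have hrev : ∀ j ≤ g, p.reverse.getVert j = (u.1, u.2 + j * -ε) := fun j hj => by
    rw [Walk.getVert_reverse, hp.2, hpε _ (by omega), Nat.cast_sub hj]
    simp
  have hεne : ε ≠ -ε := by
    have := ZMod.one_ne_neg_one_of_three_le hg
    rcases hε with rfl | rfl <;> simpa [eq_comm] using this
  refine Nat.card_eq_two_iff.2 ⟨⟨p, hp⟩, ⟨p.reverse, hp.1.reverse, by simp [hp.2]⟩, fun h => ?_, ?_⟩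
  · have h1 := hpε 1 (by omega)
    rw [show p = p.reverse from congrArg Subtype.val h, hrev 1 (by omega)] at h1
    exact hεne (by simpa using h1.symm)
  · refine Set.eq_univ_of_forall fun ⟨q, hq⟩ => ?_
    obtain ⟨δ, hδ, hqδ⟩ := hring q hq
    obtain rfl | rfl : δ = ε ∨ δ = -ε := by
      rcases hε with rfl | rfl <;> rcases hδ with rfl | rfl <;> simp
    · refine .inl (Subtype.ext (Walk.ext_getVert_le_length (hq.2.trans hp.2.symm) fun j hj => ?_))
      rw [hq.2] at hj
      exact (hqδ j hj).trans (hpε j hj).symm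
    · refine .inr (Subtype.ext (Walk.ext_getVert_le_length (by simp [hq.2, hp.2]) fun j hj => ?_))
      rw [hq.2] at hj
      exact (hqδ j hj).trans (hrev j hj).symm

lemma girth_ringReplacement (hb : IsLocallyFree b) (hg : 3 ≤ g) :
    (ringReplacement b).girth = g := by
  obtain ⟨p, hp, hl⟩ := exists_isCycle_ring hb hg ((1, 0) : H × ZMod g)
  refine le_antisymm ((girth_le_length hp).trans_eq hl) ?_
  obtain ⟨u, q, hq, hqg⟩ := exists_girth_eq_length.2 fun h => h p hp
  rw [hqg]
  by_contra! hlt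
  exact hlt.ne (length_eq_of_isCycle hb hg q hq hlt.le)

lemma isVGR_ringReplacement [Finite H] [Finite ι] (hb : IsLocallyFree b) (hg : 3 ≤ g) :
    IsVGR (ringReplacement b) (Nat.card H * g) (Nat.card ι + 2) g 1 := by
  have : NeZero g := ⟨by omega⟩
  refine ⟨inferInstance, by simp, natCard_neighborSet_ringReplacement hb hg, ?_,
    vertexCycleCount_ringReplacement hb hg⟩
  rw [girth_ringReplacement hb hg]

end RingReplacement

/-- for all `k ≥ 3` and `g ≥ 3` there are infinitely many `v`
such that a `vgr(v, k, g, 1)`-graph exists. -/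
theorem infinitely_many_vgr_lambda_one (k g : ℕ) (hk : 3 ≤ k) (hg : 3 ≤ g) :
    {v : ℕ | ∃ (V : Type) (G : SimpleGraph V), IsVGR G v k g 1}.Infinite := by
  refine Set.infinite_of_not_bddAbove fun ⟨N, hN⟩ => ?_
  have : NeZero g := ⟨by omega⟩
  obtain ⟨H, _, _, b, hb, hw⟩ := exists_finite_group_of_involutions (ZMod g × Fin (k - 2)) g
  let b' : ZMod g × Fin (k - 2) → H × Multiplicative (ZMod (N + 1)) := fun c => (b c, 1)
  have hb' : IsLocallyFree b' :=
    { mul_self := fun c => Prod.ext (hb c) (mul_one 1)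
      eq_nil := fun w hc hl h => hw w hc hl (by
        simpa [b', Function.comp_def] using
          (map_list_prod (MonoidHom.fst H (Multiplicative (ZMod (N + 1)))) _).symm.trans
            (congrArg Prod.fst h)) }
  have hV := isVGR_ringReplacement hb' hg
  rw [Nat.card_fin, Nat.sub_add_cancel (by omega)] at hV
  have hle := hN ⟨_, _, hV⟩
  have hH : 0 < Nat.card H := Nat.card_pos
  have hM : Nat.card (Multiplicative (ZMod (N + 1))) = N + 1 := Nat.card_zmod _
  rw [Nat.card_prod, hM] at hle
  nlinarith [Nat.mul_le_mul (Nat.mul_le_mul hH le_rfl : 1 * (N + 1) ≤ Nat.card H * (N + 1)) hg]
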